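/- arXiv:2508.17743 — 3 statements merged into one kernel-verified Lean document; each statement's English description precedes it below -/
import Mathlib

section
/- Let G be a simple graph on a finite vertex type and let v be a vertex of G. Then the characteristic polynomial of the Laplacian matrix satisfies φ(L(G)) = (x − d(v))·φ(L_v(G)) − Σ_{u ∈ N(v)} φ(L_{uv}(G)) − 2·Σ_{C ∈ 𝔠_G(v)} (−1)^{|V(C)|}·φ(L_{V(C)}(G)). -/
open Polynomial Matrix

attribute [local instance] Classical.propDecidable

noncomputable section

/-- The permanent of a square matrix: `per M = ∑_{σ} ∏_i M i (σ i)`. -/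
def Matrix.per {n R : Type*} [Fintype n] [DecidableEq n] [CommRing R]
    (M : Matrix n n R) : R :=
  ∑ σ : Equiv.Perm n, ∏ i, M i (σ i)

/-- The characteristic polynomial `φ(M) = det (x·I - M)`. -/
def phi {n R : Type*} [Fintype n] [DecidableEq n] [CommRing R]
    (M : Matrix n n (Polynomial R)) : Polynomial R :=
  ((Polynomial.X : Polynomial R) • (1 : Matrix n n (Polynomial R)) - M).det

/-- The permanental polynomial `ψ(M) = per (x·I - M)`. -/
def psi {n R : Type*} [Fintype n] [DecidableEq n] [CommRing R]
    (M : Matrix n n (Polynomial R)) : Polynomial R :=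
  ((Polynomial.X : Polynomial R) • (1 : Matrix n n (Polynomial R)) - M).per

variable {V : Type*}

/-- The principal submatrix of `M` obtained by deleting the rows and columns indexed by `S`. -/
def delSub {R : Type*} (M : Matrix V V R) (S : Set V) :
    Matrix {w : V // w ∉ S} {w : V // w ∉ S} R :=
  M.submatrix Subtype.val Subtype.val

/-- `C` is a cycle of `G`: a subgraph of `G` that is connected, has nonempty vertex set,
and in which every vertex of `C` has degree exactly `2` in `C`. -/
def IsCycleSub (G : SimpleGraph V) (C : G.Subgraph) : Prop :=
  C.Connected ∧ C.verts.Nonempty ∧ ∀ w ∈ C.verts, (C.neighborSet w).ncard = 2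

variable [Fintype V] [DecidableEq V]

/-- The degree diagonal matrix `D(G)` of a graph. -/
def degMat (R : Type*) [CommRing R] (G : SimpleGraph V) [DecidableRel G.Adj] :
    Matrix V V R :=
  Matrix.diagonal fun w => (G.degree w : R)

/-- The Laplacian matrix `L(G) = D(G) - A(G)`. -/
def lapMat (R : Type*) [CommRing R] (G : SimpleGraph V) [DecidableRel G.Adj] :
    Matrix V V R :=
  degMat R G - G.adjMatrix R

/-- Determinant of a principal submatrix, with fixed instances. -/
def dlt {V R : Type*} [Fintype V] [DecidableEq V] [CommRing R] (M : Matrix V V R) (S : Set V) : R :=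
  (delSub M S).det

theorem fiber_sum {V R : Type*} [Fintype V] [DecidableEq V] [CommRing R]
    (M : Matrix V V R) (v : V) (c : Equiv.Perm V) (hc : c.cycleOf v = c)
    (S : Set V) (hS : ∀ x, x ∈ S ↔ c.SameCycle v x)
    (T : Finset V) (hT : ∀ x, x ∈ T ↔ x ∈ S) :
    ∑ σ : Equiv.Perm V with σ.cycleOf v = c, ((Equiv.Perm.sign σ : ℤ) : R) * ∏ i, M (σ i) i
      = (((Equiv.Perm.sign c : ℤ) : R) * ∏ i ∈ T, M (c i) i) * dlt M S := by
  obtain rfl : T = Finset.univ.filter (fun i => i ∈ S) := by ext; simp [hT]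
  unfold dlt
  have hfix : ∀ x, x ∉ S → c x = x := fun x hx => by
    rw [← hc]; exact Equiv.Perm.cycleOf_apply_of_not_sameCycle (fun h => hx ((hS x).2 h))
  have hv : v ∈ S := (hS v).2 (Equiv.Perm.SameCycle.refl _ _)
  rw [Matrix.det_apply', Finset.mul_sum]
  symm
  refine Finset.sum_bij (fun τ _ => c * Equiv.Perm.ofSubtype τ) ?_ ?_ ?_ ?_
  · intro τ _
    simp only [Finset.mem_filter, Finset.mem_univ, true_and]
    have hd : c.Disjoint (Equiv.Perm.ofSubtype τ) := by
      intro x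
      by_cases hx : x ∈ S
      · right; exact Equiv.Perm.ofSubtype_apply_of_not_mem τ (by simpa using hx)
      · left; exact hfix x hx
    rw [Equiv.Perm.cycleOf_mul_of_apply_right_eq_self hd.commute v, hc]
    exact Equiv.Perm.ofSubtype_apply_of_not_mem τ (by simpa using hv)
  · intro a _ b _ h
    exact Equiv.Perm.ofSubtype_injective (mul_left_cancel h)
  · intro σ hσ
    simp only [Finset.mem_filter, Finset.mem_univ, true_and] at hσ
    have hSσ : ∀ x, x ∈ S → σ x = c x := by
      intro x hx
      obtain ⟨k, hk⟩ := (hS x).1 hx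
      rw [← hσ, Equiv.Perm.cycleOf_zpow_apply_self] at hk
      rw [← hσ, Equiv.Perm.SameCycle.cycleOf_apply ⟨k, hk⟩]
    have h1 : ∀ x, x ∈ S → (c⁻¹ * σ) x = x := by
      intro x hx
      simp [hSσ x hx]
    have h2 : ∀ x, (c⁻¹ * σ) x ∉ S ↔ x ∉ S := by
      intro x
      rw [not_iff_not]
      constructor
      · intro h
        have := h1 _ h
        have := (c⁻¹ * σ).injective this
        rwa [this] at h
      · intro h; rw [h1 x h]; exact h
    refine ⟨(c⁻¹ * σ).subtypePerm h2, Finset.mem_univ _, ?_⟩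
    rw [Equiv.Perm.ofSubtype_subtypePerm]
    · simp
    · intro x hx hxS; exact hx (h1 x hxS)
  · intro τ _
    rw [Equiv.Perm.sign_mul, Equiv.Perm.sign_ofSubtype,
      ← Finset.prod_filter_mul_prod_filter_not Finset.univ (fun i => i ∈ S) (fun i => M _ i)]
    have e1 : ∏ i with i ∈ S, M ((c * Equiv.Perm.ofSubtype τ) i) i = ∏ i with i ∈ S, M (c i) i := by
      refine Finset.prod_congr rfl fun i hi => ?_
      simp only [Finset.mem_filter, Finset.mem_univ, true_and] at hi
      rw [Equiv.Perm.mul_apply, Equiv.Perm.ofSubtype_apply_of_not_mem τ (by simpa using hi)]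
    have e2 : ∏ i with i ∉ S, M ((c * Equiv.Perm.ofSubtype τ) i) i
        = ∏ i, delSub M S (τ i) i := by
      rw [Finset.prod_subtype _ (p := fun i => i ∉ S) (by simp)]
      refine Finset.prod_congr (by congr!) fun i hi => ?_
      rw [Equiv.Perm.mul_apply, Equiv.Perm.ofSubtype_apply_coe, hfix _ (τ i).2]
      rfl
    rw [e1, e2]
    push_cast
    ring

/-- The subgraph carried by a permutation. -/
def permSub {V : Type*} (G : SimpleGraph V) (c : Equiv.Perm V) : G.Subgraph where
  verts := {x | c x ≠ x}
  Adj a b := G.Adj a b ∧ (c a = b ∨ c b = a)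
  adj_sub h := h.1
  edge_vert := by
    rintro a b ⟨h, h1 | h1⟩ h2
    · exact h.ne (h2.symm.trans h1)
    · apply h.ne; exact c.injective (h2.trans h1.symm)
  symm := by
    refine ⟨?_⟩
    rintro a b ⟨h, h1⟩; exact ⟨h.symm, h1.symm⟩

/-- cyclic permutations through `v`, moving along edges of `G`, of length at least three. -/
def Good {V : Type*} (G : SimpleGraph V) (v : V) (c : Equiv.Perm V) : Prop :=
  c.IsCycle ∧ c v ≠ v ∧ (∀ x, c x ≠ x → G.Adj x (c x)) ∧ c (c v) ≠ v

theorem Good.ne2 {V : Type*} {G : SimpleGraph V} {v : V} {c : Equiv.Perm V}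
    (h : Good G v c) {x : V} (hx : c x ≠ x) : c (c x) ≠ x := by
  intro hh
  have := h.1.eq_swap_of_apply_apply_eq_self hx hh
  apply h.2.2.2
  rw [this]
  simp

theorem Good.nbr {V : Type*} {G : SimpleGraph V} {v : V} {c : Equiv.Perm V}
    (h : Good G v c) {x : V} (hx : c x ≠ x) : 
    (permSub G c).neighborSet x = {c x, c⁻¹ x} := by
  ext y
  simp only [SimpleGraph.Subgraph.mem_neighborSet, permSub, Set.mem_insert_iff, 
    Set.mem_singleton_iff]
  constructor
  · rintro ⟨h1, h2 | h2⟩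
    · exact Or.inl h2.symm
    · right; rw [← h2]; simp
  · rintro (rfl | rfl)
    · exact ⟨h.2.2.1 x hx, Or.inl rfl⟩
    · refine ⟨?_, Or.inr (by simp)⟩
      have := h.2.2.1 (c⁻¹ x) (by
        intro h3; apply hx
        rw [← Equiv.Perm.mul_apply, mul_inv_cancel, Equiv.Perm.one_apply] at h3
        nth_rw 1 [h3]; simp)
      simpa using this.symm

theorem Good.ne_inv {V : Type*} {G : SimpleGraph V} {v : V} {c : Equiv.Perm V}
    (h : Good G v c) {x : V} (hx : c x ≠ x) : c x ≠ c⁻¹ x := by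
  intro hh
  apply h.ne2 hx
  rw [hh]; simp

theorem Good.inv {V : Type*} {G : SimpleGraph V} {v : V} {c : Equiv.Perm V}
    (h : Good G v c) : Good G v c⁻¹ := by
  have hv : c⁻¹ v ≠ v := fun h3 => h.2.1 (by nth_rw 1 [← h3]; simp)
  refine ⟨h.1.inv, hv, ?_, ?_⟩
  · intro x hx
    have := h.2.2.1 (c⁻¹ x) (by simpa using hx.symm)
    simpa using this.symm
  · intro h3
    exact h.2.2.2 (by nth_rw 1 [← h3]; simp)

theorem permSub_inv {V : Type*} (G : SimpleGraph V) (c : Equiv.Perm V) :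
    permSub G c⁻¹ = permSub G c := by
  ext a b
  · simp only [permSub, Set.mem_ofPred_eq]
    rw [not_iff_not, Equiv.Perm.inv_eq_iff_eq, eq_comm]
  · simp only [permSub, Equiv.Perm.inv_eq_iff_eq]
    grind

theorem Good.isCycleSub {V : Type*} {G : SimpleGraph V} {v : V} {c : Equiv.Perm V}
    (h : Good G v c) [Finite V] : IsCycleSub G (permSub G c) ∧ v ∈ (permSub G c).verts := by
  have hv : v ∈ (permSub G c).verts := h.2.1
  refine ⟨⟨?_, ⟨v, hv⟩, ?_⟩, hv⟩
  · rw [SimpleGraph.Subgraph.connected_iff']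
    have key : ∀ n : ℕ, ∀ y (hy : y ∈ (permSub G c).verts), (c ^ n) v = y →
        (permSub G c).coe.Reachable ⟨v, hv⟩ ⟨y, hy⟩ := by
      intro n
      induction n with
      | zero => intro y hy hh; simp at hh; subst hh; exact SimpleGraph.Reachable.refl _
      | succ n ih =>
        intro y hy hh
        have hm : c ((c ^ n) v) ≠ (c ^ n) v := by
          rw [← Equiv.Perm.mul_apply, ← pow_succ', pow_succ, Equiv.Perm.mul_apply]
          exact fun h3 => h.2.1 ((c ^ n).injective h3)
        refine (ih _ hm rfl).trans (SimpleGraph.Adj.reachable ?_)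
        rw [pow_succ', Equiv.Perm.mul_apply] at hh
        subst hh
        exact ⟨h.2.2.1 _ hm, Or.inl rfl⟩
    have key2 : ∀ y, (permSub G c).coe.Reachable ⟨v, hv⟩ y := by
      rintro ⟨y, hy⟩
      obtain ⟨n, hn⟩ := h.1.exists_pow_eq h.2.1 hy
      exact key n y hy hn
    have : Nonempty (permSub G c).verts := ⟨⟨v, hv⟩⟩
    exact ⟨fun a b => (key2 a).symm.trans (key2 b)⟩
  · intro w hw
    rw [h.nbr hw, Set.ncard_pair (h.ne_inv hw)]

theorem Good.eq_of_apply {V : Type*} {G : SimpleGraph V} {v : V} {c d : Equiv.Perm V}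
    [Finite V]
    (h : Good G v c) (h' : Good G v d) (hs : permSub G d = permSub G c) (hcd : d v = c v) :
    d = c := by
  have hverts : ∀ x, d x ≠ x ↔ c x ≠ x := fun x => by
    have := congrArg SimpleGraph.Subgraph.verts hs
    exact Set.ext_iff.1 this x
  have key : ∀ n : ℕ, d ((c ^ n) v) = c ((c ^ n) v) := by
    intro n
    induction n with
    | zero => simpa using hcd
    | succ n ih =>
      have hm : c ((c ^ (n + 1)) v) ≠ (c ^ (n + 1)) v := by
          rw [← Equiv.Perm.mul_apply, ← pow_succ', pow_succ, Equiv.Perm.mul_apply]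
          exact fun h3 => h.2.1 ((c ^ (n + 1)).injective h3)
      rw [pow_succ', Equiv.Perm.mul_apply] at hm ⊢
      generalize (c ^ n) v = y at *
      have h1 : d (c y) ∈ (permSub G d).neighborSet (c y) := by
        rw [h'.nbr ((hverts _).2 hm)]; simp
      rw [hs, h.nbr hm] at h1
      have hcc : c⁻¹ (c y) = y := by simp
      simp only [hcc, Set.mem_insert_iff, Set.mem_singleton_iff] at h1
      rcases h1 with h1 | h1
      · exact h1
      · exfalso
        rw [← ih] at h1
        refine h'.ne2 ?_ h1
        intro h3
        rw [h3] at ih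
        rw [← ih] at hm
        exact hm ih.symm
  ext x
  by_cases hx : c x = x
  · have : d x = x := by
      by_contra h3; exact (hverts x).1 h3 hx
    rw [hx, this]
  · obtain ⟨n, hn⟩ := h.1.exists_pow_eq h.2.1 hx
    rw [← hn]; exact key n

theorem Good.eq_or {V : Type*} {G : SimpleGraph V} {v : V} {c d : Equiv.Perm V}
    [Finite V]
    (h : Good G v c) (h' : Good G v d) (hs : permSub G d = permSub G c) :
    d = c ∨ d = c⁻¹ := by
  have hv : d v ∈ (permSub G d).neighborSet v := by
    rw [h'.nbr h'.2.1]; simp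
  rw [hs, h.nbr h.2.1] at hv
  rcases hv with hv | hv
  · left; exact h.eq_of_apply h' hs hv
  · right; exact h.inv.eq_of_apply h' (hs.trans (permSub_inv G c).symm) hv

theorem exists_good {V : Type*} [Finite V] {G : SimpleGraph V} {v : V} {C : G.Subgraph}
    (hC : IsCycleSub G C) (hv : v ∈ C.verts) : ∃ c, Good G v c ∧ permSub G c = C := by
  have hcyc : C.spanningCoe.IsCycles := by
    rintro w ⟨y, hy⟩
    exact hC.2.2 w (C.edge_vert hy)
  have hn : (C.spanningCoe.neighborSet v).Nonempty := by
    have h2 := hC.2.2 v hv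
    exact Set.nonempty_of_ncard_ne_zero (s := C.neighborSet v) (by rw [h2]; norm_num)
  obtain ⟨p, hp, hpv⟩ := hcyc.exists_cycle_toSubgraph_verts_eq_connectedComponentSupp
    (c := C.spanningCoe.connectedComponentMk v) rfl hn
  have hmem : ∀ x, x ∈ p.support.tail ↔ x ∈ C.verts := by
    intro x
    have h1 : x ∈ p.support.tail ↔ x ∈ p.support := by
      rw [SimpleGraph.Walk.mem_support_iff]
      constructor
      · exact Or.inr
      · rintro (rfl | h)
        · exact SimpleGraph.Walk.end_mem_tail_support hp.not_nil
        · exact h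
    rw [h1, ← SimpleGraph.Walk.mem_verts_toSubgraph, hpv, SimpleGraph.ConnectedComponent.mem_supp_iff,
      SimpleGraph.ConnectedComponent.eq]
    constructor
    · intro hr
      obtain ⟨q⟩ := hr
      cases q with
      | nil => exact hv
      | cons h q => exact C.edge_vert h
    · intro hx
      have := (hC.1.coe.preconnected ⟨x, hx⟩ ⟨v, hv⟩)
      exact this.map ⟨Subtype.val, fun {a b} h => h⟩
  have hl3 := hp.three_le_length
  have hlen : p.support.tail.length = p.length := by simp
  have hnd := hp.support_nodup
  set l := p.support.tail with hl
  have happ : ∀ x ∈ l, C.Adj x (l.formPerm x) := by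
    intro x hx
    obtain ⟨i, hi, rfl⟩ := List.getElem_of_mem hx
    rw [List.formPerm_apply_getElem _ hnd]
    have hget : ∀ j (hj : j < l.length), l[j] = p.getVert (j + 1) := by
      intro j hj
      rw [SimpleGraph.Walk.getVert_eq_support_getElem _ (by omega)]
      simp [hl]
    rw [hget, hget]
    by_cases h : i + 1 < l.length
    · rw [Nat.mod_eq_of_lt h]
      exact p.adj_getVert_succ (by omega)
    · have : i + 1 = l.length := by omega
      rw [this, Nat.mod_self, hlen]
      rw [SimpleGraph.Walk.getVert_length]
      have := p.adj_getVert_succ (i := 0) (by omega)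
      simpa using this
  have hne : ∀ x, l.formPerm x ≠ x ↔ x ∈ C.verts := by
    intro x
    rw [← hmem]
    constructor
    · exact List.mem_of_formPerm_apply_ne
    · intro hx
      exact (List.formPerm_apply_mem_ne_self_iff _ hnd x hx).2 (by omega)
  have hgood : Good G v l.formPerm := by
    refine ⟨List.isCycle_formPerm hnd (by omega), (hne v).2 hv, ?_, ?_⟩
    · intro x hx
      exact C.adj_sub (happ x ((hmem x).2 ((hne x).1 hx)))
    · intro h2
      obtain ⟨i, hi, hiv⟩ := List.getElem_of_mem ((hmem v).2 hv)
      rw [← hiv, List.formPerm_apply_getElem _ hnd, List.formPerm_apply_getElem _ hnd,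
        hnd.getElem_inj_iff] at h2
      rw [hlen] at h2 hi
      by_cases h : i + 1 < p.length
      · rw [Nat.mod_eq_of_lt h] at h2
        by_cases h' : i + 1 + 1 < p.length
        · rw [Nat.mod_eq_of_lt h'] at h2; omega
        · have : i + 1 + 1 = p.length := by omega
          rw [this, Nat.mod_self] at h2; omega
      · have : i + 1 = p.length := by omega
        rw [this, Nat.mod_self, Nat.mod_eq_of_lt (by omega)] at h2; omega
  refine ⟨_, hgood, ?_⟩
  have hnb : ∀ x ∈ C.verts, (permSub G l.formPerm).neighborSet x = C.neighborSet x := by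
    intro x hx
    have hx' := (hne x).2 hx
    have hsub : (permSub G l.formPerm).neighborSet x ⊆ C.neighborSet x := by
      rw [hgood.nbr hx']
      rintro y (rfl | rfl)
      · exact happ x ((hmem x).2 hx)
      · have := happ (l.formPerm⁻¹ x) (List.mem_of_formPerm_apply_mem (by
          simpa using (hmem x).2 hx))
        simpa using this.symm
    refine Set.eq_of_subset_of_ncard_le hsub ?_ (Set.toFinite _)
    rw [hC.2.2 x hx, hgood.nbr hx', Set.ncard_pair (hgood.ne_inv hx')]
  ext a b
  · exact hne a
  · constructor
    · intro h
      have ha := (hne a).1 ((permSub G l.formPerm).edge_vert h)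
      exact (Set.ext_iff.1 (hnb a ha) b).1 h
    · intro h
      have ha := C.edge_vert h
      exact (Set.ext_iff.1 (hnb a ha) b).2 h

theorem cycleOf_cycleOf_self {V : Type*} [Fintype V] [DecidableEq V] (σ : Equiv.Perm V) (v : V) :
    (σ.cycleOf v).cycleOf v = σ.cycleOf v := by
  by_cases h : σ v = v
  · rw [(Equiv.Perm.cycleOf_eq_one_iff σ).2 h, Equiv.Perm.cycleOf_one]
  · exact (Equiv.Perm.isCycle_cycleOf σ h).cycleOf_eq (by simpa using h)

theorem phi_delSub {V : Type*} [Fintype V] [DecidableEq V] (L : Matrix V V (Polynomial ℤ))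
    (S : Set V) [i1 : Fintype {w : V // w ∉ S}] [i2 : DecidableEq {w : V // w ∉ S}] :
    phi (delSub L S) =
      dlt ((Polynomial.X : Polynomial ℤ) • (1 : Matrix V V (Polynomial ℤ)) - L) S := by
  unfold phi dlt
  have e : delSub ((Polynomial.X : Polynomial ℤ) • (1 : Matrix V V (Polynomial ℤ)) - L) S =
    (Polynomial.X : Polynomial ℤ) • (1 : Matrix _ _ (Polynomial ℤ)) - delSub L S := ?_
  · rw [e]
    congr!
  ext i j : 2
  simp [delSub, Matrix.one_apply, Subtype.ext_iff]

theorem good_sum {V R : Type*} [Fintype V] [DecidableEq V] [CommRing R]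
    (G : SimpleGraph V) (v : V) (f : Set V → R) :
    ∑ c : Equiv.Perm V with Good G v c, f (permSub G c).verts =
      2 * ∑ᶠ C ∈ {C : G.Subgraph | IsCycleSub G C ∧ v ∈ C.verts}, f C.verts := by
  have hfin : {C : G.Subgraph | IsCycleSub G C ∧ v ∈ C.verts}.Finite := Set.toFinite _
  rw [finsum_mem_eq_finite_toFinset_sum _ hfin, Finset.mul_sum]
  rw [← Finset.sum_fiberwise_of_maps_to (t := hfin.toFinset) (g := permSub G)]
  · refine Finset.sum_congr rfl fun C hC => ?_
    rw [Set.Finite.mem_toFinset] at hC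
    obtain ⟨c, hc, rfl⟩ := exists_good hC.1 hC.2
    have : (({c | Good G v c} : Finset (Equiv.Perm V)).filter
        (fun d => permSub G d = permSub G c)) = {c, c⁻¹} := by
      ext d
      simp only [Finset.mem_filter, Finset.mem_univ, true_and, Finset.mem_insert,
        Finset.mem_singleton]
      constructor
      · rintro ⟨h1, h2⟩; exact hc.eq_or h1 h2
      · rintro (rfl | rfl)
        · exact ⟨hc, rfl⟩
        · exact ⟨hc.inv, permSub_inv G c⟩
    have hne : c ≠ c⁻¹ := fun h => hc.ne_inv hc.2.1 (by rw [← h])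
    rw [this, Finset.sum_pair hne, permSub_inv, two_mul]
  · intro c hc
    rw [Set.Finite.mem_toFinset]
    exact (Finset.mem_filter.1 hc).2.isCycleSub

theorem lapl_diag {V : Type*} [Fintype V] [DecidableEq V]
    (G : SimpleGraph V) [DecidableRel G.Adj] (a : V) :
    ((Polynomial.X : Polynomial ℤ) • (1 : Matrix V V (Polynomial ℤ)) - lapMat (Polynomial ℤ) G) a a
      = Polynomial.X - (G.degree a : Polynomial ℤ) := by
  simp [lapMat, degMat]

theorem lapl_offdiag {V : Type*} [Fintype V] [DecidableEq V]
    (G : SimpleGraph V) [DecidableRel G.Adj] {a b : V} (h : a ≠ b) :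
    ((Polynomial.X : Polynomial ℤ) • (1 : Matrix V V (Polynomial ℤ)) - lapMat (Polynomial ℤ) G) a b
      = if G.Adj a b then 1 else 0 := by
  simp [lapMat, degMat, h, SimpleGraph.adjMatrix_apply]

theorem laplacian_charpoly_vertex_recursion
    {V : Type*} [Fintype V] [DecidableEq V]
    (G : SimpleGraph V) [DecidableRel G.Adj] (v : V) :
    phi (lapMat (Polynomial ℤ) G) =
      (Polynomial.X - (G.degree v : Polynomial ℤ)) * phi (delSub (lapMat (Polynomial ℤ) G) {v})
        - ∑ u ∈ G.neighborFinset v, phi (delSub (lapMat (Polynomial ℤ) G) {u, v})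
        - 2 * ∑ᶠ C ∈ {C : G.Subgraph | IsCycleSub G C ∧ v ∈ C.verts},
          (-1 : Polynomial ℤ) ^ C.verts.ncard * phi (delSub (lapMat (Polynomial ℤ) G) C.verts) := by
  simp only [phi_delSub]
  rw [← good_sum G v (fun S => (-1 : Polynomial ℤ) ^ S.ncard *
    dlt ((Polynomial.X : Polynomial ℤ) • (1 : Matrix V V (Polynomial ℤ))
      - lapMat (Polynomial ℤ) G) S)]
  unfold phi
  have hdiag := lapl_diag G v
  have hoff := fun (a b : V) (h : a ≠ b) => lapl_offdiag G h
  generalize (Polynomial.X : Polynomial ℤ) • (1 : Matrix V V (Polynomial ℤ))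
    - lapMat (Polynomial ℤ) G = M at *
  rw [Matrix.det_apply', ← Finset.sum_fiberwise (g := fun σ : Equiv.Perm V => σ.cycleOf v)]
  set F : Equiv.Perm V → Polynomial ℤ := fun c => ∑ σ : Equiv.Perm V with σ.cycleOf v = c,
    ((Equiv.Perm.sign σ : ℤ) : Polynomial ℤ) * ∏ i, M (σ i) i with hF
  change ∑ c, F c = _
  have hcyc : ∀ c : Equiv.Perm V, c.IsCycle → c v ≠ v →
      F c = (((Equiv.Perm.sign c : ℤ) : Polynomial ℤ) * ∏ i ∈ c.support, M (c i) i)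
        * dlt M {x | c x ≠ x} := by
    intro c hc hv
    have hS : ∀ x, x ∈ {x | c x ≠ x} ↔ c.SameCycle v x := by
      intro x
      constructor
      · intro hx; exact hc.sameCycle hv hx
      · intro hx h; exact hv (hx.apply_eq_self_iff.2 h)
    have key := fiber_sum M v c (hc.cycleOf_eq hv) _ hS c.support (by simp)
    simp only [hF]
    convert! key
  have h1 : F 1 = (Polynomial.X - (G.degree v : Polynomial ℤ)) * dlt M {v} := by
    have := fiber_sum M v 1 (Equiv.Perm.cycleOf_one v) {v} (by simp [eq_comm]) {v} (by simp)
    rw [hF]; dsimp only; rw [this]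
    congr 1
    simp [hdiag]
  have h2 : ∀ u ∈ G.neighborFinset v, F (Equiv.swap v u) = - dlt M {u, v} := by
    intro u hu
    rw [SimpleGraph.mem_neighborFinset] at hu
    have huv := hu.ne
    rw [hcyc _ (Equiv.Perm.isCycle_swap huv) (by simpa using huv.symm)]
    have e0 : {x | Equiv.swap v u x ≠ x} = ({u, v} : Set V) := by
      ext x
      simp only [Set.mem_ofPred_eq, Set.mem_insert_iff, Set.mem_singleton_iff,
        Equiv.swap_apply_ne_self_iff]
      tauto
    rw [e0]
    rw [Equiv.Perm.support_swap huv, Finset.prod_pair huv, Equiv.swap_apply_left, Equiv.swap_apply_right,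
      hoff _ _ huv, hoff _ _ huv.symm, if_pos hu, if_pos hu.symm, Equiv.Perm.sign_swap huv]
    simp
  have h3 : ∀ c : Equiv.Perm V, Good G v c → F c =
      - ((-1 : Polynomial ℤ) ^ (permSub G c).verts.ncard * dlt M (permSub G c).verts) := by
    intro c hc
    rw [hcyc c hc.1 hc.2.1]
    have e1 : ∏ i ∈ c.support, M (c i) i = 1 := by
      refine Finset.prod_eq_one fun i hi => ?_
      have hi : c i ≠ i := Equiv.Perm.mem_support.1 hi
      rw [hoff _ _ hi, if_pos (hc.2.2.1 i hi).symm]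
    have e2 : (permSub G c).verts.ncard = c.support.card := by
      rw [← Set.ncard_coe_finset]
      congr 1
      ext x; simp [permSub]
    rw [e1, e2, hc.1.sign]
    simp [permSub]
  set B := (G.neighborFinset v).image (Equiv.swap v) with hB
  set P : Finset (Equiv.Perm V) := {c | Good G v c} with hP
  have hsub : ∑ c, F c = ∑ c ∈ ({1} ∪ B) ∪ P, F c := by
    symm
    refine Finset.sum_subset (Finset.subset_univ _) ?_
    intro c _ hc
    by_contra hne
    apply hc
    obtain ⟨σ, hσ, -⟩ := Finset.exists_ne_zero_of_sum_ne_zero hne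
    have hcc : c.cycleOf v = c := by
      have := (Finset.mem_filter.1 hσ).2
      rw [← this, cycleOf_cycleOf_self]
    simp only [Finset.mem_union, Finset.mem_singleton, hB, Finset.mem_image, hP, Finset.mem_filter,
      Finset.mem_univ, true_and, SimpleGraph.mem_neighborFinset]
    by_cases hv : c v = v
    · left; left; rw [← hcc]; exact (Equiv.Perm.cycleOf_eq_one_iff c).2 hv
    have hic : c.IsCycle := by rw [← hcc]; exact Equiv.Perm.isCycle_cycleOf c hv
    have hadj : ∀ x, c x ≠ x → G.Adj x (c x) := by
      intro x hx
      by_contra hxa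
      apply hne
      rw [hcyc c hic hv, Finset.prod_eq_zero (i := x)]
      · simp
      · simpa using hx
      · rw [hoff _ _ hx, if_neg (fun h => hxa h.symm)]
    by_cases hvv : c (c v) = v
    · left; right
      exact ⟨c v, hadj v hv, (hic.eq_swap_of_apply_apply_eq_self hv hvv).symm⟩
    · right; exact ⟨hic, hv, hadj, hvv⟩
  rw [hsub, Finset.sum_union, Finset.sum_union, Finset.sum_singleton, h1, hB, Finset.sum_image,
    Finset.sum_congr rfl h2, Finset.sum_congr rfl (fun c hc => h3 c (Finset.mem_filter.1 hc).2),
    Finset.sum_neg_distrib, Finset.sum_neg_distrib]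
  · ring
  · intro a _ b _ hab
    have := congrArg (fun e : Equiv.Perm V => e v) hab
    simpa using this
  · rw [Finset.disjoint_left]
    intro c hc hcB
    rw [Finset.mem_singleton] at hc
    obtain ⟨u, hu, hcu⟩ := Finset.mem_image.1 hcB
    rw [SimpleGraph.mem_neighborFinset] at hu
    have := congrArg (fun e : Equiv.Perm V => e v) (hcu.trans hc)
    exact hu.ne (by simpa using this.symm)
  · rw [Finset.disjoint_left]
    intro c hc hcP
    have hg := (Finset.mem_filter.1 hcP).2
    rcases Finset.mem_union.1 hc with hc | hc
    · rw [Finset.mem_singleton] at hc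
      exact hg.2.1 (by simp [hc])
    · obtain ⟨u, hu, rfl⟩ := Finset.mem_image.1 hc
      exact hg.2.2.2 (by simp)
end
end

section
/- Let G be a simple graph on a finite vertex type and let e = uv be an edge of G. Then the characteristic polynomial of the signless Laplacian matrix satisfies φ(Q(G)) = φ(Q(G − e)) − φ(Q_u(G − e)) − φ(Q_v(G − e)) − 2·Σ_{C ∈ 𝔠_G(e)} φ(Q_{V(C)}(G)). -/
open Polynomial Matrix

attribute [local instance] Classical.propDecidable

noncomputable section

variable {V : Type*}

variable [Fintype V] [DecidableEq V]

/-- The signless Laplacian matrix `Q(G) = D(G) + A(G)`. -/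
def qMat (R : Type*) [CommRing R] (G : SimpleGraph V) [DecidableRel G.Adj] :
    Matrix V V R :=
  degMat R G + G.adjMatrix R

namespace Aux

/-- rows in `S` replaced by identity rows -/
def rowId {V R : Type*} [DecidableEq V] [CommRing R] (M : Matrix V V R) (S : Set V) :
    Matrix V V R := fun i j => if i ∈ S then (1 : Matrix V V R) i j else M i j

lemma det_rowId {V R : Type*} [Fintype V] [DecidableEq V] [CommRing R] (M : Matrix V V R)
    (S : Set V) : (rowId M S).det = (delSub M S).det := by
  rw [Matrix.twoBlockTriangular_det' (rowId M S) (fun i => i ∈ S)]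
  · have h1 : toSquareBlockProp (rowId M S) (fun i => i ∈ S) = 1 := by
      ext i j
      simp [toSquareBlockProp, rowId, Matrix.one_apply, Subtype.ext_iff]
    have h2 : toSquareBlockProp (rowId M S) (fun i => ¬ i ∈ S) = delSub M S := by
      ext i j
      have := i.2
      simp [toSquareBlockProp, rowId, delSub, this]
    rw [h1, h2, det_one, one_mul]
  · intro i hi j hj
    have : i ≠ j := by rintro rfl; exact hj hi
    simp [rowId, hi, this]

lemma rowId_updateRow {V R : Type*} [DecidableEq V] [CommRing R] (M : Matrix V V R)
    (S : Set V) (a : V) :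
    (rowId M S).updateRow a (Pi.single a 1) = rowId M (insert a S) := by
  ext i j
  by_cases h : i = a
  · subst h
    simp [rowId, Matrix.one_apply, Pi.single_apply, eq_comm]
  · simp [rowId, h]

lemma adjugate_rec {V R : Type*} [Fintype V] [DecidableEq V] [CommRing R] (A : Matrix V V R)
    {a v : V} (hav : a ≠ v) :
    A.adjugate a v = ∑ w, if w = a then 0 else
      - (A a w) * (A.updateRow a (Pi.single a 1)).adjugate w v := by
  rw [adjugate_apply]
  set B := A.updateRow v (Pi.single a 1) with hB
  have h1 : B = B.updateRow a (∑ w, (A a w) • Pi.single (M := fun _ ↦ R) w 1) := by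
    rw [← pi_eq_sum_univ']
    have : A a = B a := by rw [hB, updateRow_ne hav]
    rw [this, updateRow_eq_self]
  have h2 : B.det = ∑ w, A a w * (B.updateRow a (Pi.single w 1)).det := by
    conv_lhs => rw [h1]
    have := (detRowAlternating : (V → R) [⋀^V]→ₗ[R] R).map_update_sum (t := Finset.univ) (i := a)
      (g := fun w => (A a w) • Pi.single (M := fun _ ↦ R) w 1) (m := B)
    refine this.trans ?_
    refine Finset.sum_congr rfl fun w _ => ?_
    exact det_updateRow_smul _ _ _ _
  rw [h2]
  refine Finset.sum_congr rfl fun w _ => ?_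
  split_ifs with hw
  · subst hw
    rw [det_zero_of_row_eq hav, mul_zero]
    rw [updateRow_self, updateRow_ne hav.symm, hB, updateRow_self]
  · rw [adjugate_apply, neg_mul, ← mul_neg]
    congr 1
    have := det_permute (Equiv.swap a v) ((A.updateRow a (Pi.single a 1)).updateRow v (Pi.single w 1))
    rw [Equiv.Perm.sign_swap hav] at this
    simp only [Units.val_neg, Units.val_one, Int.cast_neg, Int.cast_one, neg_mul, one_mul] at this
    rw [← this]
    congr 1
    ext i j
    by_cases hi : i = a
    · subst hi; simp
    · by_cases hv : i = v
      · subst hv; simp [hB, hi, hav]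
      · simp [hB, hi, hv, Equiv.swap_apply_of_ne_of_ne]

/-- paths avoiding `S` -/
abbrev PP {V : Type*} (H : SimpleGraph V) (S : Set V) (a v : V) : Type _ :=
  {p : H.Walk a v // p.IsPath ∧ ∀ x ∈ p.support, x ∉ S}

instance {V : Type*} [Fintype V] (H : SimpleGraph V) (S : Set V) (a v : V) :
    Finite (PP H S a v) :=
  haveI : Finite (H.Path a v) := Finite.of_fintype _
  Finite.of_injective (β := H.Path a v) (fun p => ⟨p.1, p.2.1⟩) (by
    intro p q h
    apply Subtype.ext
    simpa using h)

instance {V : Type*} [Fintype V] (H : SimpleGraph V) (S : Set V) (a v : V) :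
    Fintype (PP H S a v) := Fintype.ofFinite _

/-- prepend a vertex -/
def consP {V : Type*} (H : SimpleGraph V) (S : Set V) {a v : V} (ha : a ∉ S) :
    (Σ w : {w // H.Adj a w}, PP H (insert a S) w.1 v) → PP H S a v :=
  fun x => ⟨SimpleGraph.Walk.cons x.1.2 x.2.1, by
    obtain ⟨⟨w, hw⟩, p, hp, hS⟩ := x
    constructor
    · rw [SimpleGraph.Walk.cons_isPath_iff]
      exact ⟨hp, fun h => hS _ h (Set.mem_insert _ _)⟩
    · intro x hx
      rw [SimpleGraph.Walk.support_cons, List.mem_cons] at hx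
      rcases hx with rfl | hx
      · exact ha
      · exact fun h => hS _ hx (Set.mem_insert_of_mem _ h)⟩

lemma consP_bij {V : Type*} (H : SimpleGraph V) (S : Set V) {a v : V} (ha : a ∉ S)
    (hav : a ≠ v) : Function.Bijective (consP (v := v) H S ha) := by
  constructor
  · rintro ⟨⟨w, hw⟩, p, hp⟩ ⟨⟨w', hw'⟩, p', hp'⟩ h
    have h := congrArg Subtype.val h
    simp only [consP, SimpleGraph.Walk.cons.injEq] at h
    obtain ⟨rfl, h⟩ := h
    obtain rfl := eq_of_heq h
    rfl
  · rintro ⟨p, hp, hS⟩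
    cases p with
    | nil => exact absurd rfl hav
    | @cons _ w _ h p =>
      rw [SimpleGraph.Walk.cons_isPath_iff] at hp
      refine ⟨⟨⟨w, h⟩, p, hp.1, ?_⟩, rfl⟩
      intro x hx hx'
      rcases hx' with rfl | hx'
      · exact hp.2 hx
      · exact hS x (by simp [hx]) hx'

lemma adj_eq_path_sum {V R : Type*} [Fintype V] [DecidableEq V] [CommRing R]
    (H : SimpleGraph V) (M : Matrix V V R)
    (hM : ∀ i j, i ≠ j → M i j = if H.Adj i j then -1 else 0) (v : V) (n : ℕ) :
    ∀ (S : Set V) (a : V), Sᶜ.ncard ≤ n → v ∉ S →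
      (rowId M S).adjugate a v = ∑ p : PP H S a v, (rowId M (S ∪ {x | x ∈ p.1.support})).det := by
  induction n with
  | zero =>
    intro S a hn hv
    exfalso
    rw [Nat.le_zero, Set.ncard_eq_zero (Set.toFinite _)] at hn
    have : v ∈ Sᶜ := hv
    simp [hn] at this
  | succ n ih =>
    intro S a hn hv
    by_cases ha : a ∈ S
    · have : IsEmpty (PP H S a v) := ⟨fun p => p.2.2 a (by simp) ha⟩
      rw [Finset.univ_eq_empty, Finset.sum_empty, adjugate_apply]
      have hav : a ≠ v := by rintro rfl; exact hv ha
      apply det_zero_of_row_eq hav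
      rw [updateRow_self, updateRow_ne hav]
      ext j
      simp [rowId, ha, Matrix.one_apply, Pi.single_apply, eq_comm]
    by_cases hav : a = v
    · subst hav
      rw [adjugate_apply, rowId_updateRow]
      let p0 : PP H S a a := ⟨SimpleGraph.Walk.nil, by simp, by simpa using ha⟩
      rw [Fintype.sum_eq_single p0]
      · congr 2
        ext x; simp [p0, or_comm]
      · rintro ⟨p, hp, hS⟩ hne
        exfalso; apply hne
        apply Subtype.ext
        exact (SimpleGraph.Walk.isPath_iff_nil.1 hp).eq_nil
    · rw [adjugate_rec _ hav, ← (consP_bij H S ha hav).sum_comp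
        (fun p => (rowId M (S ∪ {x | x ∈ p.1.support})).det), Fintype.sum_sigma]
      set f : V → R := fun w => ∑ p : PP H (insert a S) w v,
        (rowId M (insert a S ∪ {x | x ∈ p.1.support})).det with hf
      have hcard : (insert a S)ᶜ.ncard ≤ n := by
        have : (insert a S)ᶜ ⊂ Sᶜ := by
          exact compl_lt_compl_iff_lt.mpr (Set.ssubset_insert ha)
        have := Set.ncard_lt_ncard this (Set.toFinite _)
        omega
      have hva : v ∉ insert a S := by
        rintro (h | h)
        · exact hav h.symm
        · exact hv h
      have h1 : ∀ x : {w // H.Adj a w}, ∑ y : PP H (insert a S) x.1 v,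
          (rowId M (S ∪ {z | z ∈ (consP H S ha ⟨x, y⟩).1.support})).det = f x.1 := by
        intro x
        refine Finset.sum_congr rfl fun y _ => ?_
        congr 2
        ext z
        simp [consP]
        tauto
      rw [Fintype.sum_congr _ _ h1, ← Finset.sum_subtype (Finset.univ.filter (H.Adj a)) (by simp) f,
        Finset.sum_filter]
      refine Finset.sum_congr rfl fun w _ => ?_
      by_cases hw : w = a
      · subst hw; simp
      · rw [if_neg hw, rowId_updateRow, ih _ w hcard hva]
        have : rowId M S a w = if H.Adj a w then -1 else 0 := by
          simp [rowId, ha, hM a w (Ne.symm hw)]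
        rw [this]
        split_ifs <;> simp [hf]

lemma path_eq_of_edges {V : Type*} {G : SimpleGraph V} {a v : V} (p : G.Walk a v) :
    ∀ (q : G.Walk a v), p.IsPath → q.IsPath → (∀ e, e ∈ p.edges ↔ e ∈ q.edges) → p = q := by
  induction p with
  | nil =>
    intro q _ hq _
    exact (SimpleGraph.Walk.isPath_iff_nil.1 hq).eq_nil.symm
  | @cons a w v h p ih =>
    intro q hp hq he
    cases q with
    | nil => exact absurd ((he s(a, w)).1 (by simp)) (by simp)
    | @cons _ w' _ h' q =>
      rw [SimpleGraph.Walk.cons_isPath_iff] at hp hq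
      have hpa : ∀ x, s(a, x) ∉ p.edges := fun x hx =>
        hp.2 (SimpleGraph.Walk.fst_mem_support_of_mem_edges _ hx)
      have hqa : ∀ x, s(a, x) ∉ q.edges := fun x hx =>
        hq.2 (SimpleGraph.Walk.fst_mem_support_of_mem_edges _ hx)
      have hww : w = w' := by
        have := (he s(a, w)).1 (by simp)
        rw [SimpleGraph.Walk.edges_cons, List.mem_cons] at this
        rcases this with h | h
        · exact Sym2.congr_right.1 h
        · exact absurd h (hqa w)
      subst hww
      congr 1
      refine ih q hp.1 hq.1 fun e => ?_
      have := he e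
      simp only [SimpleGraph.Walk.edges_cons, List.mem_cons] at this
      constructor
      · intro h1
        rcases this.1 (Or.inr h1) with rfl | h2
        · exact absurd h1 (hpa w)
        · exact h2
      · intro h1
        rcases this.2 (Or.inr h1) with rfl | h2
        · exact absurd h1 (hqa w)
        · exact h2

/-- the closed walk obtained from a path of `G - uv` by adding the edge `uv` -/
def cyc {V : Type*} {G : SimpleGraph V} {u v : V} (he : G.Adj u v)
    (p : PP (G.deleteEdges {s(u, v)}) ∅ u v) : G.Walk v v :=
  SimpleGraph.Walk.cons he.symm (p.1.mapLe (G.deleteEdges_le _))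

lemma notMem_edges {V : Type*} {G : SimpleGraph V} {u v : V}
    (p : (G.deleteEdges {s(u, v)}).Walk u v) : s(v, u) ∉ p.edges := by
  intro h
  have := SimpleGraph.Walk.edges_subset_edgeSet p h
  rw [SimpleGraph.mem_edgeSet, SimpleGraph.deleteEdges_adj] at this
  exact this.2 (by simp)

lemma cyc_isCycle {V : Type*} {G : SimpleGraph V} {u v : V} (he : G.Adj u v)
    (p : PP (G.deleteEdges {s(u, v)}) ∅ u v) : (cyc he p).IsCycle := by
  rw [cyc, SimpleGraph.Walk.cons_isCycle_iff]
  refine ⟨p.2.1.mapLe _, ?_⟩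
  rw [SimpleGraph.Walk.edges_mapLe_eq_edges]
  exact notMem_edges _

lemma cyc_inj {V : Type*} {G : SimpleGraph V} {u v : V} (he : G.Adj u v) :
    Function.Injective (fun p => (cyc he p).toSubgraph) := by
  intro p q h
  apply Subtype.ext
  refine path_eq_of_edges _ _ p.2.1 q.2.1 fun e => ?_
  have h := congrArg SimpleGraph.Subgraph.edgeSet h
  have h := Set.ext_iff.1 h e
  simp only [SimpleGraph.Walk.mem_edges_toSubgraph, cyc, SimpleGraph.Walk.edges_cons,
    SimpleGraph.Walk.edges_mapLe_eq_edges, List.mem_cons] at h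
  have hp := notMem_edges p.1
  have hq := notMem_edges q.1
  by_cases h' : e = s(v, u)
  · subst h'; tauto
  · tauto

lemma subgraph_eq {V : Type*} [Finite V] {G : SimpleGraph V} {C D : G.Subgraph}
    (hC : IsCycleSub G C) (hD : IsCycleSub G D) (h : D ≤ C) : D = C := by
  have hn : ∀ w ∈ D.verts, D.neighborSet w = C.neighborSet w := by
    intro w hw
    apply Set.eq_of_subset_of_ncard_le
    · exact fun x hx => h.2 hx
    · rw [hC.2.2 w (h.1 hw), hD.2.2 w hw]
    · exact Set.toFinite _
  have hv : ∀ a b : C.verts, C.coe.Reachable a b → a.1 ∈ D.verts → b.1 ∈ D.verts := by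
    rintro a b ⟨p⟩ ha
    induction p with
    | nil => exact ha
    | @cons x y z hxy p ih =>
      apply ih
      have h1 : y.1 ∈ C.neighborSet x.1 := by simpa using hxy
      rw [← hn _ ha] at h1
      exact D.edge_vert (SimpleGraph.Subgraph.Adj.symm h1)
  obtain ⟨a, ha⟩ := hD.2.1
  have hverts : D.verts = C.verts := by
    apply Set.Subset.antisymm h.1
    intro b hb
    exact hv ⟨a, h.1 ha⟩ ⟨b, hb⟩ (hC.1.coe.preconnected _ _) ha
  apply SimpleGraph.Subgraph.ext hverts
  ext x y
  constructor
  · exact fun hx => h.2 hx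
  · intro hx
    have := hn x (hverts ▸ C.edge_vert hx)
    have h2 : y ∈ C.neighborSet x := hx
    rw [← this] at h2
    exact h2

lemma isCycleSub_toSubgraph {V : Type*} {G : SimpleGraph V} {v : V} {c : G.Walk v v}
    (hc : c.IsCycle) : IsCycleSub G c.toSubgraph := by
  refine ⟨c.toSubgraph_connected, ⟨v, by simp⟩, fun w hw => ?_⟩
  exact hc.ncard_neighborSet_toSubgraph_eq_two (by simpa using hw)

lemma cyc_range {V : Type*} [Finite V] {G : SimpleGraph V} {u v : V} (he : G.Adj u v) :
    {C : G.Subgraph | IsCycleSub G C ∧ C.Adj u v} =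
      Set.range (fun p => (cyc he p).toSubgraph) := by
  ext C
  constructor
  · rintro ⟨hC, huv⟩
    have hcyc : C.spanningCoe.IsCycles := by
      intro w hw
      obtain ⟨x, hx⟩ := hw
      exact hC.2.2 w (C.edge_vert hx)
    have hr := SimpleGraph.IsCycles.reachable_deleteEdges (v := u) (w := v) (by simpa using huv) hcyc
    obtain ⟨p, hp⟩ := hr.exists_isPath
    have hle : C.spanningCoe.deleteEdges {s(u, v)} ≤ G.deleteEdges {s(u, v)} := by
      intro a b hab
      rw [SimpleGraph.deleteEdges_adj] at hab ⊢
      exact ⟨C.adj_sub hab.1, hab.2⟩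
    refine ⟨⟨p.mapLe hle, hp.mapLe _, by simp⟩, ?_⟩
    apply subgraph_eq hC (isCycleSub_toSubgraph (cyc_isCycle he _))
    have hadj : ∀ x y, (cyc he ⟨p.mapLe hle, hp.mapLe _, by simp⟩).toSubgraph.Adj x y →
        C.Adj x y := by
      intro x y hxy
      rw [← SimpleGraph.Subgraph.mem_edgeSet, SimpleGraph.Walk.mem_edges_toSubgraph] at hxy
      simp only [cyc, SimpleGraph.Walk.edges_cons,
        SimpleGraph.Walk.edges_mapLe_eq_edges, List.mem_cons] at hxy
      rcases hxy with h | h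
      · rw [← SimpleGraph.Subgraph.mem_edgeSet, h]
        exact huv.symm
      · have := SimpleGraph.Walk.edges_subset_edgeSet p h
        rw [SimpleGraph.mem_edgeSet, SimpleGraph.deleteEdges_adj] at this
        exact this.1
    refine ⟨fun x hx => ?_, fun x y => hadj x y⟩
    have h2 := (isCycleSub_toSubgraph (cyc_isCycle he ⟨p.mapLe hle, hp.mapLe _, by simp⟩)).2.2 x hx
    obtain ⟨y, hy⟩ := Set.nonempty_of_ncard_ne_zero (h2.trans_ne (by norm_num))
    exact C.edge_vert (hadj x y hy)
  · rintro ⟨p, rfl⟩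
    refine ⟨isCycleSub_toSubgraph (cyc_isCycle he p), ?_⟩
    simp [cyc]

/-- `x I - Q` -/
abbrev cm {V : Type*} [Fintype V] [DecidableEq V] (G : SimpleGraph V) [DecidableRel G.Adj] :
    Matrix V V (Polynomial ℤ) :=
  (X : Polynomial ℤ) • (1 : Matrix V V (Polynomial ℤ)) - qMat (Polynomial ℤ) G

lemma phi_eq {V : Type*} [Fintype V] [DecidableEq V] (G : SimpleGraph V) [DecidableRel G.Adj]
    (S : Set V) [i1 : Fintype {w : V // w ∉ S}] [i2 : DecidableEq {w : V // w ∉ S}] :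
    phi (delSub (qMat (Polynomial ℤ) G) S) = (rowId (cm G) S).det := by
  rw [det_rowId, phi]
  convert rfl using 2
  ext i j : 2
  simp [delSub, Matrix.one_apply, Subtype.ext_iff]

lemma cm_offdiag {V : Type*} [Fintype V] [DecidableEq V] (G : SimpleGraph V) [DecidableRel G.Adj]
    (i j : V) (h : i ≠ j) : cm G i j = if G.Adj i j then -1 else 0 := by
  simp only [cm, qMat, degMat, Matrix.sub_apply, Matrix.smul_apply, Matrix.add_apply,
    Matrix.one_apply_ne h, Matrix.diagonal_apply_ne _ h, SimpleGraph.adjMatrix_apply]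
  split_ifs <;> simp

lemma cm_diag {V : Type*} [Fintype V] [DecidableEq V] (G : SimpleGraph V) [DecidableRel G.Adj]
    (i : V) : cm G i i = X - (G.degree i : Polynomial ℤ) := by
  simp [cm, qMat, degMat]

lemma cm_symm {V : Type*} [Fintype V] [DecidableEq V] (G : SimpleGraph V) [DecidableRel G.Adj] :
    (cm G)ᵀ = cm G := by
  ext i j : 2
  rw [Matrix.transpose_apply]
  by_cases h : i = j
  · rw [h]
  · rw [cm_offdiag _ _ _ h, cm_offdiag _ _ _ (Ne.symm h)]
    simp [SimpleGraph.adj_comm]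

lemma degree_del {V : Type*} [Fintype V] [DecidableEq V] (G H : SimpleGraph V)
    [DecidableRel G.Adj] [DecidableRel H.Adj] {u v : V} (he : G.Adj u v)
    (hH : H = G.deleteEdges {s(u, v)}) (i : V) :
    G.degree i = H.degree i + if i = u ∨ i = v then 1 else 0 := by
  have hne := he.ne
  rw [← SimpleGraph.card_neighborFinset_eq_degree, ← SimpleGraph.card_neighborFinset_eq_degree]
  by_cases hu : i = u
  · subst hu
    have : G.neighborFinset i = insert v (H.neighborFinset i) := by
      ext x
      subst hH
      simp only [SimpleGraph.mem_neighborFinset, Finset.mem_insert, SimpleGraph.deleteEdges_adj,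
        Set.mem_singleton_iff, Sym2.eq_iff]
      by_cases hx : x = v
      · subst hx; simp [he]
      · simp [hx]; 
        tauto
    rw [this, Finset.card_insert_of_notMem (by simp [hH])]
    simp
  by_cases hv : i = v
  · subst hv
    have : G.neighborFinset i = insert u (H.neighborFinset i) := by
      ext x
      subst hH
      simp only [SimpleGraph.mem_neighborFinset, Finset.mem_insert, SimpleGraph.deleteEdges_adj,
        Set.mem_singleton_iff, Sym2.eq_iff]
      by_cases hx : x = u
      · subst hx; simp [he.symm]
      · simp [hx]; 
        tauto
    rw [this, Finset.card_insert_of_notMem (by simp [hH])]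
    simp
  · rw [if_neg (by tauto), add_zero]
    congr 1
    ext x
    subst hH
    simp only [SimpleGraph.mem_neighborFinset, SimpleGraph.deleteEdges_adj,
        Set.mem_singleton_iff, Sym2.eq_iff]
    tauto

lemma cm_del {V : Type*} [Fintype V] [DecidableEq V] (G H : SimpleGraph V)
    [DecidableRel G.Adj] [DecidableRel H.Adj] {u v : V} (he : G.Adj u v)
    (hH : H = G.deleteEdges {s(u, v)}) (i : V) :
    cm G i = if i = u ∨ i = v then
      cm H i + (-1 : Polynomial ℤ) • (Pi.single (M := fun _ => Polynomial ℤ) u 1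
        + Pi.single (M := fun _ => Polynomial ℤ) v 1) else cm H i := by
  have hne := he.ne
  have hd := degree_del G H he hH i
  ext j : 1
  by_cases hij : i = j
  · subst hij
    rw [cm_diag, hd]
    split_ifs with h
    · rw [Pi.add_apply, cm_diag]
      rcases h with rfl | rfl
      · simp [hne]; ring
      · simp [hne]; ring
    · rw [cm_diag]; simp
  · have h1 : H.Adj i j ↔ G.Adj i j ∧ ¬ (s(i, j) = s(u, v)) := by
      subst hH; simp
    rw [cm_offdiag _ _ _ hij]
    split_ifs with h2 h3 h3
    · rw [Pi.add_apply, cm_offdiag _ _ _ hij]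
      rcases h3 with rfl | rfl
      · by_cases hj : j = v
        · subst hj; simp [h1, hne]
        · rw [if_pos (by simp [h1, h2, hj, hne])]; simp [hj, Ne.symm hij]
      · by_cases hj : j = u
        · subst hj; simp [h1, hne.symm, hne]
        · rw [if_pos (by simp [h1, h2, hj, hne.symm])]; simp [hj, Ne.symm hij]
    · rw [cm_offdiag _ _ _ hij, if_pos]
      rw [h1]; simp [h2]; tauto
    · rw [Pi.add_apply, cm_offdiag _ _ _ hij, if_neg (by tauto)]
      rcases h3 with rfl | rfl
      · have : j ≠ v := by rintro rfl; exact h2 he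
        simp [this, Ne.symm hij]
      · have : j ≠ u := by rintro rfl; exact h2 he.symm
        simp [this, Ne.symm hij]
    · rw [cm_offdiag _ _ _ hij, if_neg (by tauto)]

lemma det_two_rows {V R : Type*} [Fintype V] [DecidableEq V] [CommRing R] (A B : Matrix V V R)
    {u v : V} (huv : u ≠ v) (s : V → R)
    (h : ∀ i, B i = if i = u ∨ i = v then A i + (-1 : R) • s else A i) :
    B.det = A.det - (A.updateRow u s).det - (A.updateRow v s).det := by
  have hB : B = (A.updateRow u (A u + (-1 : R) • s)).updateRow v (A v + (-1 : R) • s) := by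
    ext i : 1
    by_cases hv : i = v
    · subst hv; rw [updateRow_self, h]; simp
    · rw [updateRow_ne hv]
      by_cases hu : i = u
      · subst hu; rw [updateRow_self, h]; simp
      · rw [updateRow_ne hu, h]; simp [hu, hv]
  have h1 : (A.updateRow u (A u + (-1 : R) • s)).updateRow v (A v)
      = A.updateRow u (A u + (-1 : R) • s) := by
    conv_rhs => rw [← updateRow_eq_self (A.updateRow u (A u + (-1 : R) • s)) v]
    rw [updateRow_ne huv.symm]
  have h2 : ((A.updateRow u s).updateRow v s).det = 0 := by
    apply det_zero_of_row_eq huv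
    rw [updateRow_self, updateRow_ne huv, updateRow_self]
  have h2' : ((A.updateRow v s).updateRow u s).det = 0 := by rw [updateRow_comm _ huv.symm, h2]
  have h3 : (A.updateRow v s).updateRow u (A u) = A.updateRow v s := by
    conv_rhs => rw [← updateRow_eq_self (A.updateRow v s) u]
    rw [updateRow_ne huv]
  rw [hB, det_updateRow_add, det_updateRow_smul, h1, det_updateRow_add, det_updateRow_smul,
    updateRow_eq_self, updateRow_comm _ huv, det_updateRow_add, det_updateRow_smul, h2', h3]
  ring

end Aux

theorem signless_laplacian_charpoly_edge_recursion
    {V : Type*} [Fintype V] [DecidableEq V]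
    (G : SimpleGraph V) [DecidableRel G.Adj] (u v : V) (he : G.Adj u v) :
    phi (qMat (Polynomial ℤ) G) =
      phi (qMat (Polynomial ℤ) (G.deleteEdges {s(u, v)}))
        - phi (delSub (qMat (Polynomial ℤ) (G.deleteEdges {s(u, v)})) {u})
        - phi (delSub (qMat (Polynomial ℤ) (G.deleteEdges {s(u, v)})) {v})
        - 2 * ∑ᶠ C ∈ {C : G.Subgraph | IsCycleSub G C ∧ C.Adj u v},
          phi (delSub (qMat (Polynomial ℤ) G) C.verts) := by
  have hdel := Aux.cm_del G (G.deleteEdges {s(u, v)}) he rfl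
  have hdet := Aux.det_two_rows _ _ he.ne _ hdel
  rw [Aux.cyc_range he, finsum_mem_range (Aux.cyc_inj he), finsum_eq_sum_of_fintype]
  have hsum : ∑ p, phi (delSub (qMat (Polynomial ℤ) G) (Aux.cyc he p).toSubgraph.verts) =
      (Aux.cm (G.deleteEdges {s(u, v)})).adjugate u v := by
    have h0 : Aux.rowId (Aux.cm (G.deleteEdges {s(u, v)})) ∅
        = Aux.cm (G.deleteEdges {s(u, v)}) := by
      ext i j : 2
      simp [Aux.rowId]
    have := Aux.adj_eq_path_sum (G.deleteEdges {s(u, v)}) (Aux.cm (G.deleteEdges {s(u, v)}))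
      (fun i j h => (Aux.cm_offdiag _ i j h).trans (by congr)) v _ ∅ u le_rfl (by simp)
    rw [h0] at this
    rw [this]
    refine Finset.sum_congr rfl fun p _ => ?_
    rw [Aux.phi_eq]
    have hverts : (Aux.cyc he p).toSubgraph.verts = ∅ ∪ {x | x ∈ p.1.support} := by
      ext x
      rw [SimpleGraph.Walk.mem_verts_toSubgraph]
      simp [Aux.cyc]
      rintro rfl
      simp
    rw [hverts]
    congr 1
    ext i j : 2
    simp only [Aux.rowId]
    split_ifs with hi
    · rfl
    · rw [hdel i, if_neg]
      rintro (rfl | rfl) <;> simp at hi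
  rw [hsum, Aux.phi_eq, Aux.phi_eq]
  have hrow : ∀ w, Aux.rowId (Aux.cm (G.deleteEdges {s(u, v)})) {w}
      = (Aux.cm (G.deleteEdges {s(u, v)})).updateRow w (Pi.single w 1) := by
    intro w
    ext i j : 2
    by_cases h : i = w
    · subst h
      simp [Aux.rowId, Matrix.one_apply, Pi.single_apply, eq_comm]
    · simp [Aux.rowId, h]
  rw [hrow, hrow]
  rw [Matrix.det_updateRow_add, Matrix.det_updateRow_add] at hdet
  simp only [← Matrix.adjugate_apply] at hdet ⊢
  have hs : (Aux.cm (G.deleteEdges {s(u, v)})).adjugate v u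
      = (Aux.cm (G.deleteEdges {s(u, v)})).adjugate u v := by
    conv_lhs => rw [← Aux.cm_symm, ← Matrix.adjugate_transpose, Matrix.transpose_apply]
  rw [hs] at hdet
  change (Aux.cm G).det = (Aux.cm (G.deleteEdges {s(u, v)})).det - _ - _ - _
  rw [hdet]
  ring
end
end

section
/- Let G be a simple graph on a finite vertex type and let v be a vertex of G. Then the permanental polynomial of the signless Laplacian matrix satisfies ψ(Q(G)) = (x − d(v))·ψ(Q_v(G)) + Σ_{u ∈ N(v)} ψ(Q_{uv}(G)) + 2·Σ_{C ∈ 𝔠_G(v)} (−1)^{|V(C)|}·ψ(Q_{V(C)}(G)). -/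
open Polynomial Matrix

attribute [local instance] Classical.propDecidable

noncomputable section

variable {V : Type*}

variable [Fintype V] [DecidableEq V]

open Equiv Equiv.Perm in
theorem per_fiber {V R : Type*} [Fintype V] [DecidableEq V] [CommRing R] (B : Matrix V V R) (v : V)
    (c : Equiv.Perm V) (hc : c.cycleOf v = c) :
    ∑ σ : Equiv.Perm V with σ.cycleOf v = c, ∏ i, B i (σ i) =
      (∏ i with c.SameCycle v i, B i (c i)) * (delSub B {w | c.SameCycle v w}).per := by
  have hfix : ∀ w, ¬ c.SameCycle v w → c w = w := by
    intro w hw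
    rw [← hc]
    exact cycleOf_apply_of_not_sameCycle hw
  have hsame : ∀ σ : Perm V, σ.cycleOf v = c → ∀ w, σ.SameCycle v w ↔ c.SameCycle v w := by
    intro σ hσ w
    subst hσ
    simp only [SameCycle, cycleOf_zpow_apply_self]
  have hdisj : ∀ τ : Perm {w : V // w ∉ {w | c.SameCycle v w}}, ∀ w, c.SameCycle v w →
      Perm.ofSubtype τ w = w := by
    intro τ w hw
    exact ofSubtype_apply_of_not_mem _ (by simpa using hw)
  unfold Matrix.per
  rw [Finset.mul_sum]
  symm
  refine Finset.sum_bij (fun τ _ => c * Perm.ofSubtype τ) ?_ ?_ ?_ ?_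
  · intro τ _
    simp only [Finset.mem_filter, Finset.mem_univ, true_and]
    have hcomm : Commute c (Perm.ofSubtype τ) := by
      apply Perm.Disjoint.commute
      intro w
      by_cases hw : c.SameCycle v w
      · exact Or.inr (hdisj τ w hw)
      · exact Or.inl (hfix w hw)
    refine Eq.trans ?_ hc
    convert cycleOf_mul_of_apply_right_eq_self hcomm v (hdisj τ v (SameCycle.refl _ _))
  · intro τ _ τ' _ h
    exact ofSubtype_injective (mul_left_cancel h)
  · intro σ hσ
    simp only [Finset.mem_filter, Finset.mem_univ, true_and] at hσ
    have hs := hsame σ hσ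
    have hp : ∀ w, σ w ∉ {w | c.SameCycle v w} ↔ w ∉ {w | c.SameCycle v w} := by
      intro w
      simp only [Set.mem_ofPred_eq, ← hs, sameCycle_apply_right]
    refine ⟨σ.subtypePerm hp, Finset.mem_univ _, ?_⟩
    ext w
    by_cases hw : c.SameCycle v w
    · rw [Perm.mul_apply, hdisj _ w hw, ← hσ, SameCycle.cycleOf_apply ((hs w).2 hw)]
    · rw [Perm.mul_apply, ofSubtype_apply_of_mem (p := fun w => w ∉ {w | c.SameCycle v w}) _ hw]
      simp only [subtypePerm_apply]
      exact hfix _ (by simpa using (hp w).2 hw)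
  · intro τ _
    rw [← Finset.prod_filter_mul_prod_filter_not Finset.univ (fun i => c.SameCycle v i)
      (fun i => B i ((c * Perm.ofSubtype τ) i))]
    congr 1
    · refine Finset.prod_congr rfl fun i hi => ?_
      rw [Perm.mul_apply, hdisj τ i (Finset.mem_filter.1 hi).2]
    · symm
      rw [Finset.prod_subtype (F := inferInstance) _ (p := fun w => w ∉ {w | c.SameCycle v w}) (by simp)]
      refine Finset.prod_congr (by ext; simp) fun i _ => ?_
      rw [Perm.mul_apply, ofSubtype_apply_coe, hfix _ (by simpa using (τ i).2)]
      rfl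

theorem per_expand {V R : Type*} [Fintype V] [DecidableEq V] [CommRing R] (B : Matrix V V R) (v : V) :
    B.per = ∑ c : Equiv.Perm V with c.cycleOf v = c,
      (∏ i with c.SameCycle v i, B i (c i)) * (delSub B {w | c.SameCycle v w}).per := by
  unfold Matrix.per
  rw [← Finset.sum_fiberwise_of_maps_to (g := fun σ : Equiv.Perm V => σ.cycleOf v)
    (t := Finset.univ.filter fun c : Equiv.Perm V => c.cycleOf v = c)]
  · refine Finset.sum_congr rfl fun c hc => ?_
    exact per_fiber B v c (Finset.mem_filter.1 hc).2
  · intro σ _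
    simp only [Finset.mem_filter, Finset.mem_univ, true_and]
    by_cases h : σ v = v
    · rw [(Equiv.Perm.cycleOf_eq_one_iff σ).2 h, Equiv.Perm.cycleOf_one]
    · exact (Equiv.Perm.isCycle_cycleOf σ h).cycleOf_eq (by simpa using h)

/-- The subgraph traced out by a permutation moving vertices along edges. -/
def permGraph {V : Type*} (G : SimpleGraph V) (c : Equiv.Perm V) (hc : ∀ i, c i ≠ i → G.Adj i (c i)) :
    G.Subgraph where
  verts := {w | c w ≠ w}
  Adj a b := c a ≠ a ∧ (c a = b ∨ c b = a)
  adj_sub := by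
    rintro a b ⟨h1, h | h⟩
    · subst h; exact hc a h1
    · subst h
      exact (hc b (fun h => h1 (by rw [h]; exact h))).symm
  edge_vert := fun h => h.1
  symm := by
    constructor
    rintro a b ⟨h1, h | h⟩
    · subst h; exact ⟨fun h => h1 (c.injective h), Or.inr rfl⟩
    · subst h; exact ⟨fun h => h1 (by rw [h]; exact h), Or.inl rfl⟩

theorem permGraph_neighborSet {V : Type*} (G : SimpleGraph V) (c : Equiv.Perm V)
    (hc : ∀ i, c i ≠ i → G.Adj i (c i)) (w : V) (hw : c w ≠ w) :
    (permGraph G c hc).neighborSet w = {c w, c⁻¹ w} := by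
  ext b
  simp only [SimpleGraph.Subgraph.mem_neighborSet, permGraph, Set.mem_insert_iff,
    Set.mem_singleton_iff]
  rw [Equiv.Perm.eq_inv_iff_eq]
  constructor
  · rintro ⟨_, h | h⟩
    · exact Or.inl h.symm
    · exact Or.inr h
  · rintro (h | h)
    · exact ⟨hw, Or.inl h.symm⟩
    · exact ⟨hw, Or.inr h⟩

theorem cycle_sq_ne {V : Type*} [Finite V] (c : Equiv.Perm V) (h : c.IsCycle) (h2 : c ^ 2 ≠ 1) (w : V)
    (hw : c w ≠ w) : c (c w) ≠ w := by
  intro h'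
  exact h2 ((h.pow_eq_one_iff' hw).2 (by simpa [pow_two] using h'))

theorem permGraph_isCycleSub {V : Type*} [Finite V] (G : SimpleGraph V) (c : Equiv.Perm V)
    (hc : ∀ i, c i ≠ i → G.Adj i (c i)) (h : c.IsCycle) (h2 : c ^ 2 ≠ 1) :
    IsCycleSub G (permGraph G c hc) := by
  have hne : (permGraph G c hc).verts.Nonempty := by
    obtain ⟨x, hx, _⟩ := h
    exact ⟨x, hx⟩
  refine ⟨?_, hne, ?_⟩
  · have key : ∀ (n : ℕ) (x y : (permGraph G c hc).verts), (c ^ n) x.1 = y.1 →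
        (permGraph G c hc).coe.Reachable x y := by
      intro n
      induction n with
      | zero =>
        intro x y hxy
        have : x = y := Subtype.ext (by simpa using hxy)
        rw [this]
      | succ n ih =>
        intro x y hxy
        have hx : c x.1 ≠ x.1 := x.2
        let x' : (permGraph G c hc).verts := ⟨c x.1, fun h => hx (c.injective h)⟩
        have h1 : (permGraph G c hc).coe.Adj x x' := ⟨hx, Or.inl rfl⟩
        exact h1.reachable.trans (ih x' y (by rw [← hxy, pow_succ]; rfl))
    have : Nonempty (permGraph G c hc).verts := hne.to_subtype
    refine ⟨⟨fun x y => ?_⟩⟩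
    obtain ⟨n, hn⟩ := h.exists_pow_eq x.2 y.2
    exact key n x y hn
  · intro w hw
    rw [permGraph_neighborSet G c hc w hw]
    apply Set.ncard_pair
    rw [Ne, Equiv.Perm.eq_inv_iff_eq]
    exact cycle_sq_ne c h h2 w hw

theorem permGraph_inv {V : Type*} (G : SimpleGraph V) (c : Equiv.Perm V)
    (hc : ∀ i, c i ≠ i → G.Adj i (c i)) (hc' : ∀ i, c⁻¹ i ≠ i → G.Adj i (c⁻¹ i)) :
    permGraph G c⁻¹ hc' = permGraph G c hc := by
  have h1 : ∀ i, c⁻¹ i ≠ i ↔ c i ≠ i := by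
    intro i
    rw [Ne, Equiv.Perm.inv_eq_iff_eq, eq_comm]
  ext a b
  · exact h1 a
  · show (_ ∧ _) ↔ (_ ∧ _)
    rw [h1, Equiv.Perm.inv_eq_iff_eq, Equiv.Perm.inv_eq_iff_eq, or_comm, eq_comm (a := a), eq_comm (a := b)]

theorem permGraph_eq_aux {V : Type*} [Fintype V] [DecidableEq V] (G : SimpleGraph V) (c c' : Equiv.Perm V)
    (hc : ∀ i, c i ≠ i → G.Adj i (c i)) (hc' : ∀ i, c' i ≠ i → G.Adj i (c' i))
    (h : c.IsCycle) (h' : c'.IsCycle) (h2' : c' ^ 2 ≠ 1)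
    (v : V) (hv : c v ≠ v) (heq : permGraph G c hc = permGraph G c' hc') (hvv : c' v = c v) :
    c' = c := by
  have hs : ∀ w, c w ≠ w ↔ c' w ≠ w := by
    intro w
    exact Set.ext_iff.1 (congrArg SimpleGraph.Subgraph.verts heq) w
  have hn : ∀ w, c w ≠ w → ({c w, c⁻¹ w} : Set V) = {c' w, c'⁻¹ w} := by
    intro w hw
    rw [← permGraph_neighborSet G c hc w hw, ← permGraph_neighborSet G c' hc' w ((hs w).1 hw), heq]
  have step : ∀ n : ℕ, c' ((c ^ n) v) = c ((c ^ n) v) := by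
    intro n
    induction n with
    | zero => simpa using hvv
    | succ n ih =>
      rw [pow_succ', Equiv.Perm.mul_apply]
      set w := (c ^ n) v with hw
      have hwne : c w ≠ w := by
        intro h
        apply hv
        have : (c ^ n) (c v) = (c ^ n) v := by
          rw [← Equiv.Perm.mul_apply, ← pow_succ, pow_succ', Equiv.Perm.mul_apply]; exact h
        exact (c ^ n).injective this
      have h1 : c' (c w) ∈ ({c (c w), c⁻¹ (c w)} : Set V) := by
        rw [hn (c w) (fun h => hwne (c.injective h))]
        simp
      rcases h1 with h1 | h1
      · exact h1
      · exfalso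
        rw [Set.mem_singleton_iff, Equiv.Perm.eq_inv_iff_eq] at h1
        have h1 := c.injective h1
        rw [← ih] at h1
        exact cycle_sq_ne c' h' h2' w ((hs w).1 hwne) h1
  apply h'.support_congr h
  · intro w hw
    rw [Equiv.Perm.mem_support] at hw ⊢
    exact (hs w).2 hw
  · intro w hw
    rw [Equiv.Perm.mem_support] at hw
    obtain ⟨n, rfl⟩ := h.exists_pow_eq hv ((hs w).2 hw)
    exact step n

theorem permGraph_eq {V : Type*} [Fintype V] [DecidableEq V] (G : SimpleGraph V) (c c' : Equiv.Perm V)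
    (hc : ∀ i, c i ≠ i → G.Adj i (c i)) (hc' : ∀ i, c' i ≠ i → G.Adj i (c' i))
    (h : c.IsCycle) (h' : c'.IsCycle) (h2' : c' ^ 2 ≠ 1)
    (heq : permGraph G c hc = permGraph G c' hc') :
    c' = c ∨ c' = c⁻¹ := by
  obtain ⟨v, hv, _⟩ := id h
  have hs : c' v ≠ v :=
    (Set.ext_iff.1 (congrArg SimpleGraph.Subgraph.verts heq) v).1 hv
  have hn : ({c v, c⁻¹ v} : Set V) = {c' v, c'⁻¹ v} := by
    rw [← permGraph_neighborSet G c hc v hv, ← permGraph_neighborSet G c' hc' v hs, heq]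
  have h1 : c' v ∈ ({c v, c⁻¹ v} : Set V) := by
    rw [hn]; simp
  rcases h1 with h1 | h1
  · exact Or.inl (permGraph_eq_aux G c c' hc hc' h h' h2' v hv heq h1)
  · right
    have hci : ∀ i, c⁻¹ i ≠ i → G.Adj i (c⁻¹ i) := by
      intro i hi
      have h3 : c (c⁻¹ i) = i := Equiv.Perm.eq_inv_iff_eq.1 rfl
      have := hc (c⁻¹ i) (by rw [h3]; exact hi.symm)
      rw [h3] at this
      exact this.symm
    refine permGraph_eq_aux G c⁻¹ c' hci hc' h.inv h' h2' v ?_ ?_ h1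
    · rw [Ne, Equiv.Perm.inv_eq_iff_eq]; exact fun h => hv h.symm
    · rw [permGraph_inv G c hc hci, heq]

theorem exists_perm {V : Type*} [Fintype V] [DecidableEq V] (G : SimpleGraph V) (C : G.Subgraph)
    (hC : IsCycleSub G C) : ∃ (c : Equiv.Perm V) (hc : ∀ i, c i ≠ i → G.Adj i (c i)),
      c.IsCycle ∧ c ^ 2 ≠ 1 ∧ permGraph G c hc = C := by
  obtain ⟨hconn, ⟨v, hv⟩, hdeg⟩ := hC
  have hcyc : C.spanningCoe.IsCycles := by
    rintro w ⟨b, hb⟩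
    exact hdeg w (C.edge_vert hb)
  have hne : ∀ w ∈ C.verts, (C.neighborSet w).Nonempty := fun w hw =>
    Set.nonempty_of_ncard_ne_zero (by rw [hdeg w hw]; norm_num)
  obtain ⟨p, hp, hpv⟩ := hcyc.exists_cycle_toSubgraph_verts_eq_connectedComponentSupp
    (v := v) (c := C.spanningCoe.connectedComponentMk v) rfl (hne v hv)
  have hverts : ∀ w, w ∈ p.support ↔ w ∈ C.verts := by
    intro w
    rw [← SimpleGraph.Walk.mem_verts_toSubgraph, hpv, SimpleGraph.ConnectedComponent.mem_supp_iff,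
      SimpleGraph.ConnectedComponent.eq]
    constructor
    · rintro ⟨q⟩
      cases q with
      | nil => exact hv
      | cons h _ => exact C.edge_vert h
    · intro hw
      have hr : C.coe.Reachable ⟨w, hw⟩ ⟨v, hv⟩ := hconn.1.preconnected _ _
      let f : C.coe →g C.spanningCoe := ⟨Subtype.val, fun h => h⟩
      exact hr.map f
  have hlen : p.support.tail.length = p.length := by simp
  have h3 := hp.three_le_length
  set l := p.support.tail with hl
  have hnd : l.Nodup := hp.support_nodup
  have hmem : ∀ w, w ∈ l ↔ w ∈ C.verts := by
    intro w
    rw [← hverts]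
    exact ⟨List.mem_of_mem_tail, fun h => by
      rcases (SimpleGraph.Walk.mem_support_iff p).1 h with rfl | h
      · exact p.end_mem_tail_support hp.not_nil
      · exact h⟩
  have hget : ∀ (i : ℕ) (h : i < l.length), l[i] = p.getVert (i + 1) := by
    intro i h
    simp [hl, SimpleGraph.Walk.support_getElem_eq_getVert]
  have hadj : ∀ w ∈ l, C.Adj w (l.formPerm w) := by
    intro w hw
    obtain ⟨i, hi, rfl⟩ := List.getElem_of_mem hw
    rw [List.formPerm_apply_getElem l hnd i hi, hget, hget]
    by_cases hlast : i + 1 < l.length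
    · rw [Nat.mod_eq_of_lt hlast]
      exact p.adj_getVert_succ (by omega)
    · have : i + 1 = l.length := by omega
      rw [this, Nat.mod_self, hlen, p.getVert_length]
      have := p.adj_getVert_succ (i := 0) (by omega)
      rw [p.getVert_zero] at this
      exact this
  have hsupp : l.formPerm.support = l.toFinset :=
    List.support_formPerm_of_nodup l hnd (by rintro x hx; rw [hx] at hlen; simp at hlen; omega)
  have hsupp' : ∀ w, l.formPerm w ≠ w ↔ w ∈ l := by
    intro w
    rw [← Equiv.Perm.mem_support, hsupp, List.mem_toFinset]
  have hc : ∀ i, l.formPerm i ≠ i → G.Adj i (l.formPerm i) := fun i hi =>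
    (hadj i ((hsupp' i).1 hi)).adj_sub
  have hcy : l.formPerm.IsCycle := List.isCycle_formPerm hnd (by omega)
  have hsq : l.formPerm ^ 2 ≠ 1 := by
    intro h
    have h1 := orderOf_dvd_of_pow_eq_one h
    rw [hcy.orderOf, hsupp, List.toFinset_card_of_nodup hnd] at h1
    have := Nat.le_of_dvd (by norm_num) h1
    omega
  refine ⟨l.formPerm, hc, hcy, hsq, ?_⟩
  have hle : ∀ a b, (permGraph G l.formPerm hc).Adj a b → C.Adj a b := by
    rintro a b hab
    have hba := hab.symm
    rcases hab with ⟨h1, h | h⟩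
    · rw [← h]; exact hadj a ((hsupp' a).1 h1)
    · rw [← h]; exact (hadj b ((hsupp' b).1 hba.1)).symm
  have hdeg' := (permGraph_isCycleSub G l.formPerm hc hcy hsq).2.2
  ext a b
  · exact (hsupp' a).trans (hmem a)
  · refine ⟨hle a b, fun hab => ?_⟩
    have ha : a ∈ C.verts := C.edge_vert hab
    have heq : (permGraph G l.formPerm hc).neighborSet a = C.neighborSet a := by
      refine Set.eq_of_subset_of_ncard_le (s := (permGraph G l.formPerm hc).neighborSet a)
        (t := C.neighborSet a) (fun b hb => hle a b hb) ?_
      rw [hdeg a ha, hdeg' a ((hsupp' a).2 ((hmem a).2 ha))]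
    have : b ∈ C.neighborSet a := hab
    rw [← heq] at this
    exact this

theorem psi_delSub_eq {V : Type*} [DecidableEq V] (M : Matrix V V (Polynomial ℤ)) (S T : Set V)
    {i1 : Fintype {w // w ∉ S}} {i2 : DecidableEq {w // w ∉ S}}
    {i3 : Fintype {w // w ∉ T}} {i4 : DecidableEq {w // w ∉ T}} (h : S = T) :
    psi (delSub M S) =
      (delSub ((Polynomial.X : Polynomial ℤ) • (1 : Matrix V V (Polynomial ℤ)) - M) T).per := by
  subst h
  obtain rfl : i1 = i3 := Subsingleton.elim _ _
  obtain rfl : i2 = i4 := Subsingleton.elim _ _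
  unfold psi
  congr 1
  ext1 a b
  simp [delSub, Matrix.one_apply, Subtype.ext_iff]

theorem adj_inv {V : Type*} (G : SimpleGraph V) (c : Equiv.Perm V)
    (hc : ∀ i, c i ≠ i → G.Adj i (c i)) : ∀ i, c⁻¹ i ≠ i → G.Adj i (c⁻¹ i) := by
  intro i hi
  have h3 : c (c⁻¹ i) = i := Equiv.Perm.eq_inv_iff_eq.1 rfl
  have := hc (c⁻¹ i) (by rw [h3]; exact hi.symm)
  rw [h3] at this
  exact this.symm

/-- Sum over long cyclic permutations through `v` is twice the sum over cycles through `v`. -/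
theorem sum_long {V : Type*} [Fintype V] [DecidableEq V] (G : SimpleGraph V) (v : V)
    (f : Set V → Polynomial ℤ) :
    ∑ c : Equiv.Perm V with (c.IsCycle ∧ c v ≠ v ∧ ∀ i, c i ≠ i → G.Adj i (c i)) ∧ c ^ 2 ≠ 1,
      f {w | c w ≠ w} =
    2 * ∑ᶠ C ∈ {C : G.Subgraph | IsCycleSub G C ∧ v ∈ C.verts}, f C.verts := by
  have hfin : {C : G.Subgraph | IsCycleSub G C ∧ v ∈ C.verts}.Finite := Set.toFinite _
  rw [finsum_mem_eq_finite_toFinset_sum _ hfin, Finset.mul_sum]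
  let g : Equiv.Perm V → G.Subgraph := fun c =>
    if h : ∀ i, c i ≠ i → G.Adj i (c i) then permGraph G c h else ⊥
  have hg : ∀ (c : Equiv.Perm V) (h : ∀ i, c i ≠ i → G.Adj i (c i)), g c = permGraph G c h :=
    fun c h => dif_pos h
  rw [← Finset.sum_fiberwise_of_maps_to (g := g) (t := hfin.toFinset)]
  · refine Finset.sum_congr rfl fun C hC => ?_
    rw [Set.Finite.mem_toFinset] at hC
    obtain ⟨hC, hv⟩ := hC
    obtain ⟨c, hc, hcy, hsq, rfl⟩ := exists_perm G C hC
    have hci := adj_inv G c hc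
    have hmv : ∀ i, c⁻¹ i ≠ i ↔ c i ≠ i := by
      intro i
      rw [Ne, Equiv.Perm.inv_eq_iff_eq, eq_comm]
    have hset : {w | c⁻¹ w ≠ w} = {w | c w ≠ w} := Set.ext hmv
    have hne : c ≠ c⁻¹ := by
      intro h
      apply hsq
      rw [pow_two]
      nth_rewrite 2 [h]
      exact mul_inv_cancel c
    have hfib : ((Finset.univ.filter fun c : Equiv.Perm V =>
        (c.IsCycle ∧ c v ≠ v ∧ ∀ i, c i ≠ i → G.Adj i (c i)) ∧ c ^ 2 ≠ 1).filter
          fun c' => g c' = permGraph G c hc) = {c, c⁻¹} := by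
      ext c'
      simp only [Finset.mem_filter, Finset.mem_univ, true_and, Finset.mem_insert,
        Finset.mem_singleton]
      constructor
      · rintro ⟨⟨⟨h1, h2, h3⟩, h4⟩, h5⟩
        rw [hg c' h3] at h5
        exact permGraph_eq G c c' hc h3 hcy h1 h4 h5.symm
      · rintro (rfl | rfl)
        · exact ⟨⟨⟨hcy, hv, hc⟩, hsq⟩, hg _ hc⟩
        · refine ⟨⟨⟨hcy.inv, (hmv v).2 hv, hci⟩, ?_⟩, ?_⟩
          · rw [inv_pow]
            exact fun h => hsq (inv_eq_one.1 h)
          · rw [hg _ hci, permGraph_inv G c hc hci]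
    rw [hfib, Finset.sum_pair hne, hset, ← two_mul]
    rfl
  · intro c hc
    simp only [Finset.mem_filter, Finset.mem_univ, true_and] at hc
    obtain ⟨⟨h1, h2, h3⟩, h4⟩ := hc
    rw [Set.Finite.mem_toFinset, hg c h3]
    exact ⟨permGraph_isCycleSub G c h3 h1 h4, h2⟩

/-- Sum over transpositions through `v` is the sum over neighbours of `v`. -/
theorem sum_short {V : Type*} [Fintype V] [DecidableEq V] (G : SimpleGraph V) [DecidableRel G.Adj]
    (v : V) (f : Set V → Polynomial ℤ) :
    ∑ c : Equiv.Perm V with (c.IsCycle ∧ c v ≠ v ∧ ∀ i, c i ≠ i → G.Adj i (c i)) ∧ c ^ 2 = 1,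
      f {w | c w ≠ w} = ∑ u ∈ G.neighborFinset v, f {u, v} := by
  have hset : ∀ u, u ≠ v → ∀ w, Equiv.swap v u w ≠ w ↔ (w = v ∨ w = u) := by
    intro u hu w
    rw [Equiv.swap_apply_ne_self_iff]
    exact ⟨fun h => h.2, fun h => ⟨hu.symm, h⟩⟩
  symm
  refine Finset.sum_bij (fun u _ => Equiv.swap v u) ?_ ?_ ?_ ?_
  · intro u hu
    rw [SimpleGraph.mem_neighborFinset] at hu
    have hne : u ≠ v := hu.ne'
    simp only [Finset.mem_filter, Finset.mem_univ, true_and]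
    refine ⟨⟨Equiv.Perm.isCycle_swap hne.symm, ?_, ?_⟩, ?_⟩
    · simpa using hne
    · intro i hi
      rcases (hset u hne i).1 hi with rfl | rfl
      · simpa using hu
      · simpa using hu.symm
    · rw [pow_two, Equiv.swap_mul_self]
  · intro u _ u' _ h
    have := congrArg (fun c : Equiv.Perm V => c v) h
    simpa using this
  · intro c hc
    simp only [Finset.mem_filter, Finset.mem_univ, true_and] at hc
    obtain ⟨⟨h1, h2, h3⟩, h4⟩ := hc
    refine ⟨c v, (SimpleGraph.mem_neighborFinset _ _ _).2 (h3 v h2), ?_⟩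
    refine (h1.eq_swap_of_apply_apply_eq_self h2 ?_).symm
    have := congrArg (fun c : Equiv.Perm V => c v) h4
    simpa [pow_two] using this
  · intro u hu
    rw [SimpleGraph.mem_neighborFinset] at hu
    congr 1
    ext w
    rw [Set.mem_ofPred_eq, hset u hu.ne' w]
    simp [or_comm]

theorem per_delSub_congr {V R : Type*} [CommRing R] (M : Matrix V V R) (S T : Set V)
    {i1 : Fintype {w // w ∉ S}} {i2 : DecidableEq {w // w ∉ S}}
    {i3 : Fintype {w // w ∉ T}} {i4 : DecidableEq {w // w ∉ T}} (h : S = T) :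
    (delSub M S).per = (delSub M T).per := by
  subst h
  obtain rfl : i1 = i3 := Subsingleton.elim _ _
  obtain rfl : i2 = i4 := Subsingleton.elim _ _
  rfl

theorem signless_laplacian_permanental_vertex_recursion
    {V : Type*} [Fintype V] [DecidableEq V]
    (G : SimpleGraph V) [DecidableRel G.Adj] (v : V) :
    psi (qMat (Polynomial ℤ) G) =
      (Polynomial.X - (G.degree v : Polynomial ℤ)) * psi (delSub (qMat (Polynomial ℤ) G) {v})
        + ∑ u ∈ G.neighborFinset v, psi (delSub (qMat (Polynomial ℤ) G) {u, v})
        + 2 * ∑ᶠ C ∈ {C : G.Subgraph | IsCycleSub G C ∧ v ∈ C.verts},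
          (-1 : Polynomial ℤ) ^ C.verts.ncard * psi (delSub (qMat (Polynomial ℤ) G) C.verts) := by
  obtain ⟨B, hB⟩ : ∃ B : Matrix V V (Polynomial ℤ), B =
    (Polynomial.X : Polynomial ℤ) • (1 : Matrix V V (Polynomial ℤ)) - qMat (Polynomial ℤ) G :=
    ⟨_, rfl⟩
  let f : Set V → Polynomial ℤ := fun S => (-1 : Polynomial ℤ) ^ S.ncard * (delSub B S).per
  have hoff : ∀ i j, i ≠ j → B i j = if G.Adj i j then -1 else 0 := by
    intro i j hij
    simp only [hB, qMat, degMat, Matrix.sub_apply, Matrix.smul_apply, Matrix.add_apply,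
      Matrix.one_apply_ne hij, Matrix.diagonal_apply_ne _ hij, SimpleGraph.adjMatrix_apply]
    split_ifs <;> simp
  have hdiag : B v v = Polynomial.X - (G.degree v : Polynomial ℤ) := by
    simp [hB, qMat, degMat]
  have hmain : psi (qMat (Polynomial ℤ) G) = B.per := by rw [hB]; rfl
  have h1 : (∏ i with (1 : Equiv.Perm V).SameCycle v i, B i ((1 : Equiv.Perm V) i)) *
      (delSub B {w | (1 : Equiv.Perm V).SameCycle v w}).per =
      (Polynomial.X - (G.degree v : Polynomial ℤ)) * psi (delSub (qMat (Polynomial ℤ) G) {v}) := by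
    have hset : ∀ i, (1 : Equiv.Perm V).SameCycle v i ↔ i = v := by
      intro i
      rw [Equiv.Perm.sameCycle_one, eq_comm]
    refine congrArg₂ (· * ·) ?_ ?_
    · have : (Finset.univ.filter fun i => (1 : Equiv.Perm V).SameCycle v i) = {v} := by
        ext i
        simp [hset]
      rw [← hdiag, this, Finset.prod_singleton]
      rfl
    · rw [hB]
      symm
      apply psi_delSub_eq
      exact Set.ext fun i => (hset i).symm
  have hcyc : ∀ c : Equiv.Perm V, (c.IsCycle ∧ c v ≠ v) →
      (∏ i with c.SameCycle v i, B i (c i)) * (delSub B {w | c.SameCycle v w}).per =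
      if ∀ i, c i ≠ i → G.Adj i (c i) then f {w | c w ≠ w} else 0 := by
    rintro c ⟨hc, hv⟩
    have hs : ∀ w, c.SameCycle v w ↔ c w ≠ w := fun w =>
      ((Equiv.Perm.isCycle_iff_sameCycle hv).1 hc)
    split_ifs with h
    · refine congrArg₂ (· * ·) ?_ ?_
      swap
      · apply per_delSub_congr
        exact Set.ext hs
      rw [Finset.prod_congr rfl (g := fun _ => (-1 : Polynomial ℤ)), Finset.prod_const]
      · congr 1
        rw [Set.ncard_eq_toFinset_card']
        congr 1
        ext i
        simp [hs]
      · intro i hi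
        have hi := (hs i).1 (Finset.mem_filter.1 hi).2
        rw [hoff i (c i) hi.symm, if_pos (h i hi)]
    · push Not at h
      obtain ⟨i, hi, hna⟩ := h
      rw [Finset.prod_eq_zero (i := i) (by simpa [hs] using hi), zero_mul]
      rw [hoff i (c i) hi.symm, if_neg hna]
  have hT : (Finset.univ.filter fun c : Equiv.Perm V => c.cycleOf v = c) =
      insert 1 (Finset.univ.filter fun c : Equiv.Perm V => c.IsCycle ∧ c v ≠ v) := by
    ext c
    simp only [Finset.mem_filter, Finset.mem_univ, true_and, Finset.mem_insert]
    constructor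
    · intro h
      by_cases hv : c v = v
      · left
        rw [← h]
        exact (Equiv.Perm.cycleOf_eq_one_iff c).2 hv
      · right
        exact ⟨h ▸ Equiv.Perm.isCycle_cycleOf c hv, hv⟩
    · rintro (rfl | ⟨h, hv⟩)
      · exact Equiv.Perm.cycleOf_one v
      · exact h.cycleOf_eq hv
  rw [hmain, per_expand B v, hT, Finset.sum_insert (by simp), h1, add_assoc]
  congr 1
  rw [Finset.sum_congr rfl (fun c hc => hcyc c (Finset.mem_filter.1 hc).2), ← Finset.sum_filter,
    Finset.filter_filter, ← Finset.sum_filter_add_sum_filter_not _ (fun c => c ^ 2 = 1),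
    Finset.filter_filter, Finset.filter_filter]
  refine congrArg₂ (· + ·) ?_ ?_
  · refine Eq.trans (Finset.sum_congr ?_ fun _ _ => rfl) ((sum_short G v f).trans ?_)
    · ext c
      simp only [Finset.mem_filter, Finset.mem_univ, true_and, and_assoc]
    · refine Finset.sum_congr rfl fun u hu => ?_
      have h2 : f {u, v} = (delSub B {u, v}).per := by
        show (-1 : Polynomial ℤ) ^ ({u, v} : Set V).ncard * _ = _
        rw [Set.ncard_pair ((SimpleGraph.mem_neighborFinset _ _ _).1 hu).ne', neg_one_sq, one_mul]
        exact per_delSub_congr _ _ _ rfl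
      rw [h2, hB]
      exact (psi_delSub_eq _ _ _ rfl).symm
  · refine Eq.trans (Finset.sum_congr ?_ fun _ _ => rfl) ((sum_long G v f).trans ?_)
    · ext c
      simp only [Finset.mem_filter, Finset.mem_univ, true_and, and_assoc, ne_eq]
    · refine congrArg (2 * ·) (finsum_mem_congr rfl fun C _ => ?_)
      refine congrArg (_ * ·) ?_
      rw [hB]
      exact (psi_delSub_eq _ _ _ rfl).symm
end
end
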